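/- There is a function ε(n), depending only on the alphabet sizes J and K and satisfying ε(n)/((ln n)/n) → 0 as n → ∞, such that every non-prefix d-semifaithful code C_n = (φ_n, f_n, g_n) satisfies, for every p ∈ P(A) and ρ ∈ D, (1/n)·E_p[ l(f_n(φ_n(X^n)))·ln 2 ] ≥ E_p[R(T,d,ρ)] − (JK + J − 1)·(ln n)/n + ε(n). -/

import Mathlib

open Filter MeasureTheory
open scoped BigOperators

noncomputable section

variable {A B : Type*}

/-- `p` is a probability distribution on the finite alphabet `A`. -/
def IsProb [Fintype A] (p : A → ℝ) : Prop :=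
  (∀ a, 0 ≤ p a) ∧ ∑ a, p a = 1

/-- `Q` is a conditional probability distribution from `A` to `B`. -/
def IsCondProb [Fintype A] [Fintype B] (Q : A → B → ℝ) : Prop :=
  ∀ j, IsProb (Q j)

/-- `ρ` is a distortion measure in the class `D`: bounded in `[0, ρmax]` and
with `max_j min_k ρ(j,k) = 0` (equivalently, every row contains a zero). -/
def IsDistMeasure [Fintype A] [Fintype B] (ρmax : ℝ) (ρ : A → B → ℝ) : Prop :=
  (∀ j k, 0 ≤ ρ j k ∧ ρ j k ≤ ρmax) ∧ ∀ j, ∃ k, ρ j k = 0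

/-- Mutual information `I(p, Q)` in nats. -/
def mutualInfo [Fintype A] [Fintype B] (p : A → ℝ) (Q : A → B → ℝ) : ℝ :=
  ∑ j, ∑ k, p j * Q j k * Real.log (Q j k / ∑ j', p j' * Q j' k)

/-- Average distortion `Σ_{j,k} p(j) Q(k|j) ρ(j,k)`. -/
def avgDist [Fintype A] [Fintype B] (p : A → ℝ) (Q : A → B → ℝ) (ρ : A → B → ℝ) : ℝ :=
  ∑ j, ∑ k, p j * Q j k * ρ j k

/-- The rate-distortion function `R(p,d,ρ)` in nats. -/
def RD [Fintype A] [Fintype B] (p : A → ℝ) (d : ℝ) (ρ : A → B → ℝ) : ℝ :=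
  sInf { r | ∃ Q, IsCondProb Q ∧ avgDist p Q ρ ≤ d ∧ r = mutualInfo p Q }

/-- The type (empirical distribution) of a sequence `x ∈ A^n`. -/
def typeOf [DecidableEq A] {n : ℕ} (x : Fin n → A) : A → ℝ :=
  fun a => ((Finset.univ.filter fun i => x i = a).card : ℝ) / n

/-- The i.i.d. product probability `p^n(x) = ∏ i p(x_i)`. -/
def prodProb {n : ℕ} (p : A → ℝ) (x : Fin n → A) : ℝ :=
  ∏ i, p (x i)

/-- The `n`-fold single-letter distortion `ρ_n(x,y) = (1/n) Σ_i ρ(x_i, y_i)`. -/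
def nDist {n : ℕ} (ρ : A → B → ℝ) (x : Fin n → A) (y : Fin n → B) : ℝ :=
  (∑ i, ρ (x i) (y i)) / n

/-- `E_p[R(T,d,ρ)]`, the expectation of the empirical rate-distortion function
over `X^n` i.i.d. `p` (written as a sum over sequences). -/
def expTypeRD [Fintype A] [DecidableEq A] [Fintype B] (n : ℕ) (p : A → ℝ)
    (d : ℝ) (ρ : A → B → ℝ) : ℝ :=
  ∑ x : Fin n → A, prodProb p x * RD (typeOf x) d ρ


/-- joint count -/
def jc {n J K : ℕ} (x : Fin n → Fin J) (y : Fin n → Fin K) (j : Fin J) (k : Fin K) : ℕ :=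
  (Finset.univ.filter fun i => x i = j ∧ y i = k).card

/-- single count -/
def sc {n J : ℕ} (x : Fin n → Fin J) (j : Fin J) : ℕ :=
  (Finset.univ.filter fun i => x i = j).card

/-- maximum conditional likelihood -/
def ml {n J K : ℕ} (x : Fin n → Fin J) (y : Fin n → Fin K) : ℝ :=
  ∏ i, ((jc x y (x i) (y i) : ℝ) / sc y (y i))

lemma sum_jc_left {n J K : ℕ} (x : Fin n → Fin J) (y : Fin n → Fin K) (k : Fin K) :
    ∑ j, jc x y j k = sc y k := by
  unfold jc sc
  rw [Finset.card_eq_sum_card_fiberwise (f := x) (t := Finset.univ) (by intro i _; simp)]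
  refine Finset.sum_congr rfl fun j _ => ?_
  congr 1
  ext i
  simp [and_comm]

lemma sum_jc_right {n J K : ℕ} (x : Fin n → Fin J) (y : Fin n → Fin K) (j : Fin J) :
    ∑ k, jc x y j k = sc x j := by
  unfold jc sc
  rw [Finset.card_eq_sum_card_fiberwise (f := y) (t := Finset.univ) (by intro i _; simp)]
  refine Finset.sum_congr rfl fun j _ => ?_
  congr 1
  ext i
  simp

lemma sc_pos {n J : ℕ} (x : Fin n → Fin J) (i : Fin n) : 0 < sc x (x i) :=
  Finset.card_pos.2 ⟨i, by simp⟩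

lemma jc_pos {n J K : ℕ} (x : Fin n → Fin J) (y : Fin n → Fin K) (i : Fin n) :
    0 < jc x y (x i) (y i) :=
  Finset.card_pos.2 ⟨i, by simp⟩

lemma jc_le {n J K : ℕ} (x : Fin n → Fin J) (y : Fin n → Fin K) (j : Fin J) (k : Fin K) :
    jc x y j k ≤ n := by
  unfold jc
  exact (Finset.card_le_univ _).trans (by simp)

lemma sum_sc {n J : ℕ} (x : Fin n → Fin J) (F : Fin J → ℝ) :
    ∑ i, F (x i) = ∑ j, (sc x j : ℝ) * F j := by
  rw [← Finset.sum_fiberwise (s := Finset.univ) (g := x)]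
  refine Finset.sum_congr rfl fun j _ => ?_
  rw [Finset.sum_congr rfl (g := fun _ => F j) (fun i hi => by rw [(Finset.mem_filter.1 hi).2])]
  simp [sc]

lemma sum_jc {n J K : ℕ} (x : Fin n → Fin J) (y : Fin n → Fin K) (F : Fin J → Fin K → ℝ) :
    ∑ i, F (x i) (y i) = ∑ j, ∑ k, (jc x y j k : ℝ) * F j k := by
  rw [← Finset.sum_fiberwise (s := Finset.univ) (g := x)]
  refine Finset.sum_congr rfl fun j _ => ?_
  rw [← Finset.sum_fiberwise (s := Finset.univ.filter fun i => x i = j) (g := y)]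
  refine Finset.sum_congr rfl fun k _ => ?_
  rw [Finset.filter_filter]
  rw [Finset.sum_congr rfl (g := fun _ => F j k) (fun i hi => by
    rw [(Finset.mem_filter.1 hi).2.1, (Finset.mem_filter.1 hi).2.2])]
  simp [jc]

lemma ml_nonneg {n J K : ℕ} (x : Fin n → Fin J) (y : Fin n → Fin K) : 0 ≤ ml x y :=
  Finset.prod_nonneg fun _ _ => by positivity

lemma card_jc {n J K : ℕ} (hJ : 0 < J) (y : Fin n → Fin K) :
    ((Finset.univ : Finset (Fin n → Fin J)).image fun x => jc x y).card
      ≤ (n + 1) ^ (J * K + J - 2) := by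
  rcases Nat.lt_or_ge J 2 with h | h
  · obtain rfl : J = 1 := by omega
    refine Finset.card_image_le.trans ?_
    simp only [Finset.card_univ, Fintype.card_fun, Fintype.card_fin, one_pow]
    exact Nat.one_le_pow _ _ (by omega)
  · let S : Finset (Fin J → Fin K → ℕ) :=
      Finset.univ.image fun (g : Fin J → Fin K → Fin (n+1)) => fun j k => (g j k : ℕ)
    have h1 : ((Finset.univ : Finset (Fin n → Fin J)).image fun x => jc x y) ⊆ S := by
      intro N hN
      obtain ⟨x, -, rfl⟩ := Finset.mem_image.1 hN
      refine Finset.mem_image.2 ⟨fun j k => ⟨jc x y j k, Nat.lt_succ_of_le (jc_le x y j k)⟩,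
        Finset.mem_univ _, rfl⟩
    refine (Finset.card_le_card h1).trans (Finset.card_image_le.trans ?_)
    simp only [Finset.card_univ, Fintype.card_fun, Fintype.card_fin]
    rw [← pow_mul, mul_comm K J]
    exact Nat.pow_le_pow_right (by omega) (by omega)

lemma sum_ml {n J K : ℕ} (hJ : 0 < J) (y : Fin n → Fin K) :
    ∑ x : Fin n → Fin J, ml x y ≤ ((n : ℝ) + 1) ^ (J * K + J - 2) := by
  rw [← Finset.sum_fiberwise_of_maps_to (s := Finset.univ)
    (t := (Finset.univ : Finset (Fin n → Fin J)).image fun x => jc x y) (g := fun x => jc x y)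
    (fun x hx => Finset.mem_image_of_mem _ hx)]
  have key : ∀ N ∈ (Finset.univ : Finset (Fin n → Fin J)).image (fun x => jc x y),
      ∑ x with jc x y = N, ml x y ≤ 1 := by
    intro N hN
    obtain ⟨x0, -, rfl⟩ := Finset.mem_image.1 hN
    calc ∑ x with jc x y = jc x0 y, ml x y
        = ∑ x with jc x y = jc x0 y, ∏ i, ((jc x0 y (x i) (y i) : ℝ) / sc y (y i)) := by
          refine Finset.sum_congr rfl fun x hx => ?_
          rw [ml, (Finset.mem_filter.1 hx).2]
      _ ≤ ∑ x : Fin n → Fin J, ∏ i, ((jc x0 y (x i) (y i) : ℝ) / sc y (y i)) :=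
          Finset.sum_le_sum_of_subset_of_nonneg (Finset.filter_subset _ _)
            fun x _ _ => Finset.prod_nonneg fun _ _ => by positivity
      _ = ∏ i, ∑ j, ((jc x0 y j (y i) : ℝ) / sc y (y i)) := by
          rw [Finset.prod_univ_sum, Fintype.piFinset_univ]
      _ = 1 := by
          refine Finset.prod_eq_one fun i _ => ?_
          rw [← Finset.sum_div, ← Nat.cast_sum, sum_jc_left]
          have := sc_pos y i
          field_simp
  refine (Finset.sum_le_sum key).trans ?_
  simp only [Finset.sum_const, nsmul_eq_mul, mul_one]
  exact_mod_cast card_jc hJ y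

/-- Non-prefix Kraft sum. -/
lemma kraft (S : Finset (List Bool)) (L : ℕ) (hS : S.card ≤ 2 ^ L) :
    ∑ s ∈ S, ((1:ℝ) / 2) ^ s.length ≤ L + 1 := by
  rw [← Finset.sum_filter_add_sum_filter_not S (fun s => s.length < L)]
  refine add_le_add ?_ ?_
  · rw [← Finset.sum_fiberwise_of_maps_to (t := Finset.range L) (g := fun s => s.length)
      (fun s hs => by simpa using (Finset.mem_filter.1 hs).2)]
    have : ∀ m ∈ Finset.range L,
        ∑ s ∈ (S.filter fun s => s.length < L) with s.length = m, ((1:ℝ) / 2) ^ s.length ≤ 1 := by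
      intro m _
      have hc : ((S.filter fun s => s.length < L).filter fun s => s.length = m).card ≤ 2 ^ m := by
        have : ((S.filter fun s => s.length < L).filter fun s => s.length = m) ⊆
            (Finset.univ : Finset (List.Vector Bool m)).image (fun v => v.toList) := by
          intro s hs
          have h := (Finset.mem_filter.1 hs).2
          exact Finset.mem_image.2 ⟨⟨s, h⟩, Finset.mem_univ _, rfl⟩
        refine (Finset.card_le_card this).trans (Finset.card_image_le.trans ?_)
        simp
      rw [Finset.sum_congr rfl (g := fun _ => ((1:ℝ) / 2) ^ m)
        (fun s hs => by rw [(Finset.mem_filter.1 hs).2])]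
      rw [Finset.sum_const, nsmul_eq_mul]
      calc _ ≤ (2:ℝ) ^ m * (1 / 2) ^ m := by
            gcongr
            exact_mod_cast hc
        _ = 1 := by rw [← mul_pow]; norm_num
    refine (Finset.sum_le_sum this).trans ?_
    simp
  · calc ∑ s ∈ S with ¬ s.length < L, ((1:ℝ) / 2) ^ s.length
        ≤ ∑ s ∈ S with ¬ s.length < L, ((1:ℝ) / 2) ^ L := by
          refine Finset.sum_le_sum fun s hs => ?_
          exact pow_le_pow_of_le_one (by norm_num) (by norm_num)
            (not_lt.1 (Finset.mem_filter.1 hs).2)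
      _ ≤ (2:ℝ) ^ L * (1 / 2) ^ L := by
          rw [Finset.sum_const, nsmul_eq_mul]
          gcongr
          exact_mod_cast (Finset.card_filter_le _ _).trans hS
      _ = 1 := by rw [← mul_pow]; norm_num

lemma mutualInfo_nonneg' {J K : ℕ} (p : Fin J → ℝ) (hp : IsProb p) (Q : Fin J → Fin K → ℝ)
    (hQ : IsCondProb Q) : 0 ≤ mutualInfo p Q := by
  set q : Fin K → ℝ := fun k => ∑ j, p j * Q j k with hq
  have hpq : ∀ j k, p j * Q j k ≤ q k := fun j k =>
    Finset.single_le_sum (f := fun j => p j * Q j k)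
      (fun j _ => mul_nonneg (hp.1 j) ((hQ j).1 k)) (Finset.mem_univ j)
  have hqs : ∑ k, q k = 1 := by
    rw [hq, Finset.sum_comm]
    simp_rw [← Finset.mul_sum, (hQ _).2, mul_one]
    exact hp.2
  have h0 : ∑ j, ∑ k, (p j * Q j k - p j * q k) = 0 := by
    simp_rw [Finset.sum_sub_distrib, ← Finset.mul_sum, (hQ _).2, hqs]
    simp
  rw [← h0]
  unfold mutualInfo
  refine Finset.sum_le_sum fun j _ => Finset.sum_le_sum fun k _ => ?_
  change _ ≤ p j * Q j k * Real.log (Q j k / q k)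
  have hpj := hp.1 j
  have hQk := (hQ j).1 k
  have hle := hpq j k
  have hq0 : 0 ≤ q k := (mul_nonneg hpj hQk).trans hle
  rcases eq_or_lt_of_le hpj with h | h
  · simp [← h]
  rcases eq_or_lt_of_le hQk with h' | h'
  · simp only [← h', mul_zero, zero_sub, zero_mul]
    have := mul_nonneg hpj hq0
    linarith
  have hqp : 0 < q k := lt_of_lt_of_le (mul_pos h h') hle
  have hl := Real.one_sub_inv_le_log_of_pos (div_pos h' hqp)
  calc p j * Q j k - p j * q k = p j * Q j k * (1 - (Q j k / q k)⁻¹) := by field_simp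
    _ ≤ _ := by gcongr

lemma isProb_typeOf {n J : ℕ} (hn : 0 < n) (x : Fin n → Fin J) : IsProb (typeOf x) := by
  refine ⟨fun a => by unfold typeOf; positivity, ?_⟩
  have := sum_sc x (fun _ => 1)
  simp only [mul_one, Finset.sum_const, Finset.card_univ, Fintype.card_fin, nsmul_eq_mul] at this
  unfold typeOf
  rw [← Finset.sum_div]
  unfold sc at this
  rw [← this]
  have : (n:ℝ) ≠ 0 := by positivity
  field_simp

lemma typeOf_eq {n J : ℕ} (x : Fin n → Fin J) (j : Fin J) :
    typeOf x j = (sc x j : ℝ) / n := rfl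

lemma prodProb_le {n J : ℕ} (hn : 0 < n) (p : Fin J → ℝ) (hp : IsProb p) (x : Fin n → Fin J) :
    prodProb p x ≤ ∏ i, typeOf x (x i) := by
  have hnR : (0:ℝ) < n := by exact_mod_cast hn
  have hT : ∀ i, 0 < typeOf x (x i) := fun i => by
    rw [typeOf_eq]
    have := sc_pos x i
    positivity
  have h1 : ∏ i, (p (x i) / typeOf x (x i)) ≤ 1 := by
    calc ∏ i, (p (x i) / typeOf x (x i))
        ≤ ∏ i, Real.exp (p (x i) / typeOf x (x i) - 1) := by
          refine Finset.prod_le_prod (fun i _ => div_nonneg (hp.1 _) (hT i).le) fun i _ => ?_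
          have := Real.add_one_le_exp (p (x i) / typeOf x (x i) - 1)
          linarith
      _ = Real.exp (∑ i, (p (x i) / typeOf x (x i) - 1)) := (Real.exp_sum _ _).symm
      _ ≤ 1 := by
          rw [Real.exp_le_one_iff, Finset.sum_sub_distrib]
          rw [sum_sc x (fun j => p j / typeOf x j)]
          have : ∑ j, (sc x j : ℝ) * (p j / typeOf x j) ≤ ∑ j, (n:ℝ) * p j := by
            refine Finset.sum_le_sum fun j _ => ?_
            rw [typeOf_eq]
            have hpj := hp.1 j
            rcases Nat.eq_zero_or_pos (sc x j) with h | h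
            · simp only [h, Nat.cast_zero, zero_mul]; positivity
            · have : (0:ℝ) < sc x j := by exact_mod_cast h
              apply le_of_eq
              field_simp
          rw [← Finset.mul_sum, hp.2] at this
          simp
          linarith
  rw [Finset.prod_div_distrib, div_le_one (Finset.prod_pos fun i _ => hT i)] at h1
  exact h1

lemma exp_RD_le {n J K : ℕ} (hn : 0 < n) (hK : 0 < K) (x : Fin n → Fin J) (y : Fin n → Fin K)
    (d : ℝ) (ρ : Fin J → Fin K → ℝ) (hd : nDist ρ x y ≤ d) :
    (∏ i, typeOf x (x i)) * Real.exp (n * RD (typeOf x) d ρ) ≤ ml x y := by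
  have hnR : (0:ℝ) < n := by exact_mod_cast hn
  set Q : Fin J → Fin K → ℝ := fun j k =>
    if sc x j = 0 then (if k = ⟨0, hK⟩ then 1 else 0) else (jc x y j k : ℝ) / sc x j with hQd
  have hQ : IsCondProb Q := by
    intro j
    by_cases h : sc x j = 0
    · simp only [hQd, h, if_true]
      refine ⟨fun a => ?_, by simp⟩
      beta_reduce
      split_ifs <;> norm_num
    · simp only [hQd, h, if_false]
      refine ⟨fun a => by positivity, ?_⟩
      rw [← Finset.sum_div, ← Nat.cast_sum, sum_jc_right]
      have : (sc x j : ℝ) ≠ 0 := by exact_mod_cast h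
      field_simp
  have hTQ : ∀ j k, typeOf x j * Q j k = (jc x y j k : ℝ) / n := by
    intro j k
    rw [typeOf_eq]
    by_cases h : sc x j = 0
    · have h2 : jc x y j k = 0 := by
        have := sum_jc_right x y j
        rw [h, Finset.sum_eq_zero_iff] at this
        exact this k (Finset.mem_univ _)
      simp [h, h2]
    · simp only [hQd, h, if_false]
      have : (sc x j : ℝ) ≠ 0 := by exact_mod_cast h
      field_simp
  have hav : avgDist (typeOf x) Q ρ ≤ d := by
    refine le_of_eq_of_le ?_ hd
    unfold avgDist nDist
    rw [sum_jc x y ρ, Finset.sum_div]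
    refine Finset.sum_congr rfl fun j _ => ?_
    rw [Finset.sum_div]
    refine Finset.sum_congr rfl fun k _ => ?_
    rw [hTQ]; ring
  have hR : RD (typeOf x) d ρ ≤ mutualInfo (typeOf x) Q := by
    refine csInf_le ⟨0, ?_⟩ ⟨Q, hQ, hav, rfl⟩
    rintro r ⟨Q', hQ', -, rfl⟩
    exact mutualInfo_nonneg' _ (isProb_typeOf hn x) _ hQ'
  have hI : n * mutualInfo (typeOf x) Q
      = ∑ i, Real.log (Q (x i) (y i) / ((sc y (y i) : ℝ) / n)) := by
    rw [sum_jc x y (fun j k => Real.log (Q j k / ((sc y k : ℝ) / n)))]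
    unfold mutualInfo
    rw [Finset.mul_sum]
    refine Finset.sum_congr rfl fun j _ => ?_
    rw [Finset.mul_sum]
    refine Finset.sum_congr rfl fun k _ => ?_
    have : ∑ j', typeOf x j' * Q j' k = (sc y k : ℝ) / n := by
      simp_rw [hTQ]
      rw [← Finset.sum_div, ← Nat.cast_sum, sum_jc_left]
    rw [this, hTQ]
    field_simp
  have hTpos : ∀ i, 0 < typeOf x (x i) := fun i => by
    rw [typeOf_eq]
    have := sc_pos x i
    positivity
  calc (∏ i, typeOf x (x i)) * Real.exp (n * RD (typeOf x) d ρ)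
      ≤ (∏ i, typeOf x (x i)) * Real.exp (n * mutualInfo (typeOf x) Q) := by
        have := Finset.prod_nonneg (s := Finset.univ) fun i _ => (hTpos i).le
        gcongr
    _ = ml x y := by
        rw [hI, Real.exp_sum, ← Finset.prod_mul_distrib, ml]
        refine Finset.prod_congr rfl fun i _ => ?_
        have h1 : (0:ℝ) < sc x (x i) := by exact_mod_cast sc_pos x i
        have h2 : (0:ℝ) < sc y (y i) := by exact_mod_cast sc_pos y i
        have h3 : (0:ℝ) < jc x y (x i) (y i) := by exact_mod_cast jc_pos x y i
        have h4 : Q (x i) (y i) = (jc x y (x i) (y i) : ℝ) / sc x (x i) := by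
          simp only [hQd, (sc_pos x i).ne', if_false]
        rw [h4, Real.exp_log (by positivity), typeOf_eq]
        field_simp

lemma sum_prodProb {n J : ℕ} (p : Fin J → ℝ) (hp : IsProb p) :
    ∑ x : Fin n → Fin J, prodProb p x = 1 := by
  unfold prodProb
  have := Finset.prod_univ_sum (fun _ : Fin n => (Finset.univ : Finset (Fin J))) (fun _ j => p j)
  rw [Fintype.piFinset_univ] at this
  rw [← this]
  simp [hp.2]

lemma prodProb_nonneg {n J : ℕ} (p : Fin J → ℝ) (hp : IsProb p) (x : Fin n → Fin J) :
    0 ≤ prodProb p x := Finset.prod_nonneg fun _ _ => hp.1 _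

lemma main_sum {n J K : ℕ} (hn : 0 < n) (hJ : 0 < J) (hK : 0 < K) (d : ℝ)
    (φ : (Fin n → Fin J) → (Fin n → Fin K)) (f : (Fin n → Fin K) → List Bool)
    (g : List Bool → (Fin n → Fin K)) (ρ : Fin J → Fin K → ℝ)
    (hd : ∀ x, nDist ρ x (φ x) ≤ d) (hg : ∀ x, g (f (φ x)) = φ x)
    (p : Fin J → ℝ) (hp : IsProb p) :
    ∑ x : Fin n → Fin J, prodProb p x *
      Real.exp (n * RD (typeOf x) d ρ - ((f (φ x)).length : ℝ) * Real.log 2)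
      ≤ K * ((n:ℝ) + 1) ^ (J * K + J - 1) := by
  have hexp : ∀ m : ℕ, Real.exp (-((m:ℝ) * Real.log 2)) = ((1:ℝ) / 2) ^ m := by
    intro m
    rw [Real.exp_neg, Real.exp_nat_mul, Real.exp_log (by norm_num)]
    simp
  calc ∑ x : Fin n → Fin J, prodProb p x *
      Real.exp (n * RD (typeOf x) d ρ - ((f (φ x)).length : ℝ) * Real.log 2)
      ≤ ∑ x : Fin n → Fin J, ml x (φ x) * ((1:ℝ) / 2) ^ (f (φ x)).length := by
        refine Finset.sum_le_sum fun x _ => ?_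
        rw [sub_eq_add_neg, Real.exp_add, hexp, ← mul_assoc]
        refine mul_le_mul_of_nonneg_right ?_ (by positivity)
        refine le_trans ?_ (exp_RD_le hn hK x (φ x) d ρ (hd x))
        exact mul_le_mul_of_nonneg_right (prodProb_le hn p hp x) (Real.exp_pos _).le
    _ = ∑ y ∈ Finset.univ.image φ, ∑ x with φ x = y, ml x (φ x) * ((1:ℝ) / 2) ^ (f (φ x)).length :=
        (Finset.sum_fiberwise_of_maps_to (fun x hx => Finset.mem_image_of_mem _ hx) _).symm
    _ ≤ ∑ y ∈ Finset.univ.image φ, ((1:ℝ) / 2) ^ (f y).length * ((n:ℝ) + 1) ^ (J * K + J - 2) := by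
        refine Finset.sum_le_sum fun y _ => ?_
        rw [Finset.sum_congr rfl (g := fun x => ((1:ℝ) / 2) ^ (f y).length * ml x y)
          (fun x hx => by rw [(Finset.mem_filter.1 hx).2, mul_comm]), ← Finset.mul_sum]
        refine mul_le_mul_of_nonneg_left ?_ (by positivity)
        refine le_trans ?_ (sum_ml hJ y)
        exact Finset.sum_le_sum_of_subset_of_nonneg (Finset.filter_subset _ _)
            fun x _ _ => ml_nonneg x y
    _ = (∑ s ∈ (Finset.univ.image φ).image f, ((1:ℝ) / 2) ^ s.length)
          * ((n:ℝ) + 1) ^ (J * K + J - 2) := by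
        rw [← Finset.sum_mul, Finset.sum_image (s := Finset.univ.image φ) (g := f)]
        intro a ha b hb hab
        obtain ⟨a', -, rfl⟩ := Finset.mem_image.1 (Finset.mem_coe.1 ha)
        obtain ⟨b', -, rfl⟩ := Finset.mem_image.1 (Finset.mem_coe.1 hb)
        rw [← hg a', ← hg b', hab]
    _ ≤ (((K * n : ℕ) : ℝ) + 1) * ((n:ℝ) + 1) ^ (J * K + J - 2) := by
        refine mul_le_mul_of_nonneg_right (kraft _ _ ?_) (by positivity)
        refine Finset.card_image_le.trans ((Finset.card_le_univ _).trans ?_)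
        simp only [Fintype.card_fun, Fintype.card_fin]
        rw [pow_mul]
        exact Nat.pow_le_pow_left Nat.lt_two_pow_self.le _
    _ ≤ (K * ((n:ℝ) + 1)) * ((n:ℝ) + 1) ^ (J * K + J - 2) := by
        refine mul_le_mul_of_nonneg_right ?_ (by positivity)
        have : (1:ℝ) ≤ K := by exact_mod_cast hK
        push_cast
        linarith
    _ = K * ((n:ℝ) + 1) ^ (J * K + J - 1) := by
        have h1 : 1 ≤ J * K := Nat.mul_pos hJ hK
        have : J * K + J - 1 = (J * K + J - 2) + 1 := by omega
        rw [this, pow_succ]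
        ring

/-- Lemma 6: there is a function `ε(n)`, depending only on `J` and `K`,
with `ε(n)/((ln n)/n) → 0`, such that every (not necessarily prefix) `d`-semifaithful
code satisfies, for every `p ∈ P(A)` and every `ρ ∈ D`,
`(1/n) E_p[l(f_n(φ_n(X^n))) ln 2] ≥ E_p[R(T,d,ρ)] − (JK+J−1)(ln n)/n + ε(n)`. -/
theorem nonprefix_code_lower_bound (J K : ℕ) (hJ : 0 < J) (hK : 0 < K) :
    ∃ ε : ℕ → ℝ,
      Tendsto (fun n : ℕ => ε n / (Real.log n / n)) atTop (nhds 0) ∧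
      ∀ (ρmax : ℝ), 0 < ρmax → ∀ (d : ℝ), 0 < d → ∀ (n : ℕ)
        (φ : (Fin n → Fin J) → (Fin n → Fin K))
        (f : (Fin n → Fin K) → List Bool)
        (g : List Bool → (Fin n → Fin K))
        (ρ : Fin J → Fin K → ℝ), IsDistMeasure ρmax ρ →
        -- d-semifaithful
        (∀ x, nDist ρ x (φ x) ≤ d) →
        -- lossless binary encoder/decoder pair on the codebook
        (∀ x, g (f (φ x)) = φ x) →
        ∀ (p : Fin J → ℝ), IsProb p →
        (1 / (n : ℝ)) * ∑ x : Fin n → Fin J, prodProb p x * (((f (φ x)).length : ℝ) * Real.log 2)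
          ≥ expTypeRD n p d ρ
            - ((J : ℝ) * K + J - 1) * (Real.log n / n)
            + ε n := by
  have hKR : (1:ℝ) ≤ K := by exact_mod_cast hK
  set C : ℝ := Real.log K + ((J : ℝ) * K + J - 1) * Real.log 2 with hC
  refine ⟨fun n => -C / n, ?_, ?_⟩
  · have h : Tendsto (fun n : ℕ => -C / Real.log n) atTop (nhds 0) :=
      (Real.tendsto_log_atTop.comp tendsto_natCast_atTop_atTop).const_div_atTop (-C)
    refine h.congr' ?_
    filter_upwards [eventually_gt_atTop 0] with n hn
    have : (n:ℝ) ≠ 0 := by positivity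
    rw [div_div_div_cancel_right₀ this]
  · intro ρmax _ d hd0 n φ f g ρ hρ hd hg p hp
    rcases Nat.eq_zero_or_pos n with rfl | hn
    · have hmi : ∀ (x : Fin 0 → Fin J) (Q : Fin J → Fin K → ℝ), mutualInfo (typeOf x) Q = 0 := by
        intro x Q
        simp [mutualInfo, typeOf]
      have hRD : ∀ x : Fin 0 → Fin J, RD (typeOf x) d ρ ≤ 0 := by
        intro x
        unfold RD
        refine Real.sInf_nonpos ?_
        rintro r ⟨Q, -, -, rfl⟩
        exact (hmi x Q).le
      have : expTypeRD 0 p d ρ ≤ 0 := by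
        unfold expTypeRD
        exact Finset.sum_nonpos fun x _ =>
          mul_nonpos_of_nonneg_of_nonpos (prodProb_nonneg p hp x) (hRD x)
      simpa using this
    have hnR : (0:ℝ) < n := by exact_mod_cast hn
    have hm := main_sum hn hJ hK d φ f g ρ hd hg p hp
    have hj := convexOn_exp.map_sum_le (t := Finset.univ) (w := fun x => prodProb p x)
      (p := fun x : Fin n → Fin J =>
        (n:ℝ) * RD (typeOf x) d ρ - ((f (φ x)).length : ℝ) * Real.log 2)
      (fun x _ => prodProb_nonneg p hp x) (sum_prodProb p hp) (fun _ _ => Set.mem_univ _)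
    simp only [smul_eq_mul] at hj
    have h2 := hj.trans hm
    rw [← Real.le_log_iff_exp_le (by positivity)] at h2
    rw [Real.log_mul (by positivity) (by positivity), Real.log_pow] at h2
    have hcast : ((J * K + J - 1 : ℕ) : ℝ) = (J : ℝ) * K + J - 1 := by
      rw [Nat.cast_sub (by omega)]
      push_cast
      ring
    rw [hcast] at h2
    have hc0 : 0 ≤ (J : ℝ) * K + J - 1 := by rw [← hcast]; positivity
    have hlog : Real.log ((n:ℝ) + 1) ≤ Real.log n + Real.log 2 := by
      rw [← Real.log_mul (by positivity) (by norm_num)]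
      have : (1:ℝ) ≤ n := by exact_mod_cast hn
      exact Real.log_le_log (by positivity) (by linarith)
    have h3 := mul_le_mul_of_nonneg_left hlog hc0
    have h4 : ∑ x : Fin n → Fin J, prodProb p x *
        ((n:ℝ) * RD (typeOf x) d ρ - ((f (φ x)).length : ℝ) * Real.log 2)
        = n * expTypeRD n p d ρ
          - ∑ x : Fin n → Fin J, prodProb p x * (((f (φ x)).length : ℝ) * Real.log 2) := by
      unfold expTypeRD
      rw [Finset.mul_sum, ← Finset.sum_sub_distrib]
      exact Finset.sum_congr rfl fun x _ => by ring
    rw [h4] at h2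
    have h5 : n * expTypeRD n p d ρ - ((J : ℝ) * K + J - 1) * Real.log n - C ≤
        ∑ x : Fin n → Fin J, prodProb p x * (((f (φ x)).length : ℝ) * Real.log 2) := by
      rw [hC]
      linarith
    have h6 := mul_le_mul_of_nonneg_left h5 (one_div_pos.2 hnR).le
    refine ge_iff_le.2 (le_trans (le_of_eq ?_) h6)
    field_simp
    ring
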